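/- In the observation setting, for every a ∈ 𝒜̄ and every q ∈ J⁻(p⁺) \ I⁻(p⁻): (i) s₋₂ ≤ f_a⁺(q) ≤ s₊₂; (ii) μ_a(f_a⁺(q)) ∈ J⁺(q) and τ(q, μ_a(f_a⁺(q))) = 0, the function s ↦ τ(q, μ_a(s)) is continuous and non-decreasing on [−1,1], and it is strictly increasing on [f_a⁺(q), 1]; and (iii) the function (a,q) ↦ f_a⁺(q) is continuous on 𝒜̄ × (J⁻(p⁺) \ I⁻(p⁻)). -/

import Mathlib

set_option autoImplicit false
set_option maxHeartbeats 1000000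

noncomputable section

open Filter Topology MeasureTheory Asymptotics

/-- Abstract data of a smooth, time-oriented, globally hyperbolic Lorentzian manifold `(M,g)`.
`M` is the underlying space and `Vec` is a model for tangent vectors.  The listed
axioms express, among other things, global hyperbolicity of the causal structure. -/
structure Spacetime (M : Type) (Vec : Type) [TopologicalSpace M] where
  /-- chronological relation: `chron x y` iff there is a future-pointing time-like path
  from `x` to `y`, i.e. `x ≪ y` -/
  chron : M → M → Prop
  /-- causal relation `x ≤ y` -/
  causal : M → M → Prop
  /-- `chronWithin V x y` : there is a future-pointing time-like path from `x` to `y`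
  staying inside `V` -/
  chronWithin : Set M → M → M → Prop
  /-- time separation function `τ` -/
  timeSep : M → M → ℝ
  /-- the Lorentzian metric `g` -/
  metric : M → Vec → Vec → ℝ
  /-- the Ricci curvature tensor of `g` -/
  ricci : M → Vec → Vec → ℝ
  /-- the set of future-pointing light-like vectors at a point, `L⁺ₓM` -/
  lightlike : M → Set Vec
  /-- the geodesic `t ↦ γ_{x,ξ}(t) = exp_x (t ξ)` (junk value outside `geoDom`) -/
  geo : M → Vec → ℝ → M
  /-- the velocity `γ̇_{x,ξ}(t)` of the geodesic -/
  geoVel : M → Vec → ℝ → Vec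
  /-- the parameter set on which the geodesic `γ_{x,ξ}` is defined -/
  geoDom : M → Vec → Set ℝ
  /-- the maximal forward existence time `T(x,ξ)` of the geodesic `γ_{x,ξ}` -/
  Tmax : M → Vec → EReal
  /-- the cut locus function `ρ(x,ξ) = sup {s ∈ [0,T(x,ξ)) : τ(x,γ_{x,ξ}(s)) = 0}` -/
  cut : M → Vec → EReal
  /-- the musical isomorphism `v ↦ v^♭` -/
  flat : M → Vec → Vec
  /-- the norm of the auxiliary complete Riemannian metric `g⁺` -/
  rnorm : M → Vec → ℝ
  /-- the distance function of the auxiliary Riemannian metric `g⁺` on `M` -/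
  distM : M → M → ℝ
  /-- the Sasaki distance of `g⁺` on the tangent bundle `TM = M × Vec` -/
  sasaki : M × Vec → M × Vec → ℝ
  /-- the dimension of the manifold -/
  dim : ℕ
  /-- predicate: a curve is a future-pointing time-like geodesic of `g` -/
  IsTimelikeGeodesic : (ℝ → M) → Prop
  /-- predicate: the given functions form a `C^∞`-smooth coordinate system on a set -/
  IsCoordChart : Set M → (M → (Fin dim → ℝ)) → Prop
  /-- the gradient of a function with respect to `g` -/
  grad : (M → ℝ) → M → Vec
  /-- the class of `C^∞` functions on `M` -/
  SmoothFn : Set (M → ℝ)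
  /-- the class of `C⁶` functions on `M` -/
  C6Fn : Set (M → ℝ)
  /-- the Lorentzian Laplace–Beltrami (wave) operator `□_g` -/
  box : (M → ℝ) → (M → ℝ)
  chron_isOpen : IsOpen {p : M × M | chron p.1 p.2}
  chron_imp_causal : ∀ x y, chron x y → causal x y
  causal_refl : ∀ x, causal x x
  causal_trans : ∀ x y z, causal x y → causal y z → causal x z
  chron_causal_trans : ∀ x y z, chron x y → causal y z → chron x z
  causal_chron_trans : ∀ x y z, causal x y → chron y z → chron x z
  causal_antisymm : ∀ x y, causal x y → causal y x → x = y
  timeSep_nonneg : ∀ x y, 0 ≤ timeSep x y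
  timeSep_pos_iff : ∀ x y, 0 < timeSep x y ↔ chron x y
  timeSep_continuous : Continuous fun p : M × M => timeSep p.1 p.2
  timeSep_rev_triangle : ∀ x y z, causal x y → causal y z →
    timeSep x y + timeSep y z ≤ timeSep x z
  causal_isClosed : IsClosed {p : M × M | causal p.1 p.2}
  diamond_compact : ∀ x y, IsCompact {z | causal x z ∧ causal z y}
  chronWithin_univ : ∀ x y, chronWithin Set.univ x y ↔ chron x y
  chronWithin_mono : ∀ (V W : Set M) (x y : M), V ⊆ W → chronWithin V x y → chronWithin W x y
  chronWithin_chron : ∀ (V : Set M) (x y : M), chronWithin V x y → chron x y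
  geo_zero : ∀ x ξ, geo x ξ 0 = x
  geoVel_zero : ∀ x ξ, geoVel x ξ 0 = ξ
  geoDom_zero : ∀ x ξ, (0 : ℝ) ∈ geoDom x ξ
  cut_nonneg : ∀ x ξ, (0 : EReal) ≤ cut x ξ
  cut_le_Tmax : ∀ x ξ, cut x ξ ≤ Tmax x ξ

namespace Spacetime

variable {M : Type} {Vec : Type} [TopologicalSpace M]

/-- the chronological future `I⁺(p)` -/
def Ifut (S : Spacetime M Vec) (p : M) : Set M := {q | S.chron p q}

/-- the chronological past `I⁻(p)` -/
def Ipast (S : Spacetime M Vec) (p : M) : Set M := {q | S.chron q p}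

/-- the causal future `J⁺(p)` -/
def Jfut (S : Spacetime M Vec) (p : M) : Set M := {q | S.causal p q}

/-- the causal past `J⁻(p)` -/
def Jpast (S : Spacetime M Vec) (p : M) : Set M := {q | S.causal q p}

/-- the causal future `J⁺(A)` of a set -/
def JfutSet (S : Spacetime M Vec) (A : Set M) : Set M := {q | ∃ p ∈ A, S.causal p q}

/-- the causal past `J⁻(A)` of a set -/
def JpastSet (S : Spacetime M Vec) (A : Set M) : Set M := {q | ∃ p ∈ A, S.causal q p}

/-- the chronological diamond `I(p,q) = I⁺(p) ∩ I⁻(q)` -/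
def Idiamond (S : Spacetime M Vec) (p q : M) : Set M := S.Ifut p ∩ S.Ipast q

/-- the causal diamond `J(p,q) = J⁺(p) ∩ J⁻(q)` -/
def Jdiamond (S : Spacetime M Vec) (p q : M) : Set M := S.Jfut p ∩ S.Jpast q

/-- the future light cone `L⁺(q)` emanating from `q` -/
def lightCone (S : Spacetime M Vec) (q : M) : Set M :=
  insert q {x | ∃ ξ ∈ S.lightlike q, ∃ t : ℝ, 0 ≤ t ∧ x = S.geo q ξ t}

/-- the light observation set `P_V(q) = L⁺(q) ∩ V` -/
def obsSet (S : Spacetime M Vec) (V : Set M) (q : M) : Set M := S.lightCone q ∩ V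

/-- the earliest light observation set `E_V(q)`: the points of `P_V(q)` that cannot be
reached from another point of `P_V(q)` along a future-pointing time-like path in `V` -/
def earliestObs (S : Spacetime M Vec) (V : Set M) (q : M) : Set M :=
  {x ∈ S.obsSet V q | ¬ ∃ y ∈ S.obsSet V q, S.chronWithin V y x}

/-- the (unindexed) collection `E_V(W) = {E_V(q) : q ∈ W}` -/
def earliestObsFamily (S : Spacetime M Vec) (V W : Set M) : Set (Set M) :=
  (fun q => S.earliestObs V q) '' W

end Spacetime

/-- The observation setting: a globally hyperbolic spacetime together with a family of
smooth future-pointing time-like observer paths `μ_a : [-1,1] → M`, indexed by a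
connected metric space `𝒜 = A` whose completion `𝒜̄ = Abar` is compact, such that
`(a,s) ↦ μ_a(s)` is continuous on `𝒜̄ × [-1,1]` and open on `𝒜 × [-1,1]`, with a
distinguished observer `μ̂ = μ_â` and parameters `-1 < s₋₂ < s₋ < s₊ < s₊₂ < 1`
satisfying `μ_a(s₋₂) ∈ I⁺(μ̂(-1)) ∩ I⁻(p⁻)` and `μ_a(s₊₂) ∈ I⁻(μ̂(1)) ∩ I⁺(p⁺)`
for all `a ∈ 𝒜̄`, where `p^± = μ̂(s_±)`. -/
structure ObsSetting (M : Type) (Vec : Type) (Abar : Type) [TopologicalSpace M]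
    [MetricSpace Abar] extends Spacetime M Vec where
  /-- the index set `𝒜`, a dense connected subset of its compact completion `𝒜̄` -/
  A : Set Abar
  denseA : Dense A
  connA : IsConnected A
  /-- the observer paths `μ_a` -/
  μpath : Abar → ℝ → M
  μ_contOn : ContinuousOn (fun p : Abar × ℝ => μpath p.1 p.2)
    (Set.univ ×ˢ Set.Icc (-1 : ℝ) 1)
  μ_openMap : IsOpenMap fun p : {a // a ∈ A} × {s : ℝ // s ∈ Set.Icc (-1 : ℝ) 1} =>
    μpath p.1.1 p.2.1
  μ_timelike : ∀ (a : Abar) (s s' : ℝ), -1 ≤ s → s < s' → s' ≤ 1 →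
    chron (μpath a s) (μpath a s')
  /-- the distinguished observer index `â ∈ 𝒜` -/
  ahat : Abar
  ahat_mem : ahat ∈ A
  sm2 : ℝ
  sminus : ℝ
  splus : ℝ
  sp2 : ℝ
  hs1 : -1 < sm2
  hs2 : sm2 < sminus
  hs3 : sminus < splus
  hs4 : splus < sp2
  hs5 : sp2 < 1
  cond_low : ∀ a : Abar,
    chron (μpath ahat (-1)) (μpath a sm2) ∧ chron (μpath a sm2) (μpath ahat sminus)
  cond_high : ∀ a : Abar,
    chron (μpath ahat splus) (μpath a sp2) ∧ chron (μpath a sp2) (μpath ahat 1)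

namespace ObsSetting

variable {M Vec Abar : Type} [TopologicalSpace M] [MetricSpace Abar]

/-- the point `p⁻ = μ̂(s₋)` -/
def pminus (O : ObsSetting M Vec Abar) : M := O.μpath O.ahat O.sminus

/-- the point `p⁺ = μ̂(s₊)` -/
def pplus (O : ObsSetting M Vec Abar) : M := O.μpath O.ahat O.splus

/-- the observation set `U = ⋃_{a ∈ 𝒜} μ_a([-1,1])` -/
def U (O : ObsSetting M Vec Abar) : Set M :=
  ⋃ a ∈ O.A, O.μpath a '' Set.Icc (-1 : ℝ) 1

/-- the earliest observation time `f_a⁺(x) = inf ({s ∈ (-1,1) : τ(x,μ_a(s)) > 0} ∪ {1})` -/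
def fplus (O : ObsSetting M Vec Abar) (a : Abar) (x : M) : ℝ :=
  sInf ({s : ℝ | -1 < s ∧ s < 1 ∧ 0 < O.timeSep x (O.μpath a s)} ∪ {1})

/-- the latest observation time `f_a⁻(x) = sup ({s ∈ (-1,1) : τ(μ_a(s),x) > 0} ∪ {-1})` -/
def fminus (O : ObsSetting M Vec Abar) (a : Abar) (x : M) : ℝ :=
  sSup ({s : ℝ | -1 < s ∧ s < 1 ∧ 0 < O.timeSep (O.μpath a s) x} ∪ {-1})

/-- the direction set `𝒷_U(q)` -/
def dirSet (O : ObsSetting M Vec Abar) (q : M) : Set (M × Vec) :=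
  {p | p.1 ∈ O.U ∧ ∃ ξ ∈ O.lightlike q, ∃ t : ℝ, 0 ≤ t ∧ (t : EReal) ≤ O.cut q ξ ∧
    p.1 = O.geo q ξ t ∧ p.2 = O.geoVel q ξ t}

/-- the regular direction set `𝒷_U^{reg}(q)` -/
def regDirSet (O : ObsSetting M Vec Abar) (q : M) : Set (M × Vec) :=
  {p | p.1 ∈ O.U ∧ ∃ ξ ∈ O.lightlike q, ∃ t : ℝ, 0 < t ∧ (t : EReal) < O.cut q ξ ∧
    p.1 = O.geo q ξ t ∧ p.2 = O.geoVel q ξ t}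

/-- the regular earliest light observation set `E_U^{reg}(q) = π(𝒷_U^{reg}(q))` -/
def regEarliestObs (O : ObsSetting M Vec Abar) (q : M) : Set M :=
  Prod.fst '' O.regDirSet q

end ObsSetting

namespace ObsSetting

variable {M Vec Abar : Type} [TopologicalSpace M] [MetricSpace Abar]

theorem continuousOn_μpath (O : ObsSetting M Vec Abar) (a : Abar) :
    ContinuousOn (O.μpath a) (Set.Icc (-1 : ℝ) 1) :=
  O.μ_contOn.comp (f := fun s : ℝ => (a, s)) (by fun_prop)
    fun _ hs => ⟨Set.mem_univ _, hs⟩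

theorem continuous_μpath_left (O : ObsSetting M Vec Abar) {s : ℝ}
    (hs : s ∈ Set.Icc (-1 : ℝ) 1) : Continuous fun a => O.μpath a s :=
  O.μ_contOn.comp_continuous (f := fun a : Abar => (a, s)) (by fun_prop)
    fun _ => ⟨Set.mem_univ _, hs⟩

theorem bddBelow_fplus_set (O : ObsSetting M Vec Abar) (a : Abar) (x : M) :
    BddBelow ({s : ℝ | -1 < s ∧ s < 1 ∧ 0 < O.timeSep x (O.μpath a s)} ∪ {1}) := by
  refine ⟨-1, ?_⟩
  rintro s (⟨h, -, -⟩ | rfl)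
  · exact h.le
  · norm_num

theorem fplus_le_of_chron (O : ObsSetting M Vec Abar) {a : Abar} {x : M} {s : ℝ}
    (h₁ : -1 < s) (h₂ : s < 1) (h : O.chron x (O.μpath a s)) : O.fplus a x ≤ s :=
  csInf_le (O.bddBelow_fplus_set a x) (Or.inl ⟨h₁, h₂, (O.timeSep_pos_iff _ _).2 h⟩)

theorem le_fplus_of_not_causal (O : ObsSetting M Vec Abar) {a : Abar} {x : M} {s : ℝ}
    (h₂ : s ≤ 1) (h : ¬ O.causal x (O.μpath a s)) : s ≤ O.fplus a x := by
  refine le_csInf ⟨1, Or.inr rfl⟩ ?_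
  rintro t (⟨ht₁, -, ht⟩ | rfl)
  · by_contra! hts
    exact h (O.chron_imp_causal _ _ (O.chron_causal_trans _ _ _ ((O.timeSep_pos_iff _ _).1 ht)
      (O.chron_imp_causal _ _ (O.μ_timelike a t s ht₁.le hts h₂))))
  · exact h₂

theorem not_causal_of_lt_fplus (O : ObsSetting M Vec Abar) {a : Abar} {x : M} {s : ℝ}
    (h₁ : -1 ≤ s) (h : s < O.fplus a x) : ¬ O.causal x (O.μpath a s) := by
  intro hc
  have hf : O.fplus a x ≤ 1 := csInf_le (O.bddBelow_fplus_set a x) (Or.inr rfl)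
  obtain ⟨t, hst, htf⟩ := exists_between h
  exact htf.not_ge (O.fplus_le_of_chron (h₁.trans_lt hst) (htf.trans_le hf)
    (O.causal_chron_trans _ _ _ hc (O.μ_timelike a s t h₁ hst (htf.le.trans hf))))

theorem chron_of_fplus_lt (O : ObsSetting M Vec Abar) {a : Abar} {x : M} {s : ℝ}
    (h : O.fplus a x < s) (h₂ : s ≤ 1) : O.chron x (O.μpath a s) := by
  obtain ⟨t, ht, hts⟩ := exists_lt_of_csInf_lt (Set.union_nonempty.2 (.inr (Set.singleton_nonempty _))) h
  rcases ht with ⟨ht₁, -, ht⟩ | rfl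
  · exact O.chron_causal_trans _ _ _ ((O.timeSep_pos_iff _ _).1 ht)
      (O.chron_imp_causal _ _ (O.μ_timelike a t s ht₁.le hts h₂))
  · exact absurd hts h₂.not_gt

theorem sm2_le_fplus (O : ObsSetting M Vec Abar) (a : Abar) {q : M}
    (hq : ¬ O.chron q O.pminus) : O.sm2 ≤ O.fplus a q := by
  refine O.le_fplus_of_not_causal ?_ fun h =>
    hq (O.causal_chron_trans _ _ _ h (O.cond_low a).2)
  linarith [O.hs2, O.hs3, O.hs4, O.hs5]

theorem fplus_le_sp2 (O : ObsSetting M Vec Abar) (a : Abar) {q : M}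
    (hq : O.causal q O.pplus) : O.fplus a q ≤ O.sp2 := by
  refine O.fplus_le_of_chron ?_ O.hs5 (O.causal_chron_trans _ _ _ hq (O.cond_high a).1)
  linarith [O.hs1, O.hs2, O.hs3, O.hs4]

theorem causal_fplus (O : ObsSetting M Vec Abar) {a : Abar} {q : M}
    (h₁ : -1 ≤ O.fplus a q) (h₂ : O.fplus a q < 1) :
    O.causal q (O.μpath a (O.fplus a q)) := by
  have hcont : Tendsto (O.μpath a) (𝓝[>] (O.fplus a q)) (𝓝 (O.μpath a (O.fplus a q))) :=
    ((O.continuousOn_μpath a _ ⟨h₁, h₂.le⟩).mono_of_mem_nhdsWithin <| by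
      filter_upwards [Ioc_mem_nhdsGT h₂] with s hs
      exact ⟨h₁.trans hs.1.le, hs.2⟩)
  refine O.causal_isClosed.mem_of_tendsto (tendsto_const_nhds.prodMk_nhds hcont) ?_
  filter_upwards [Ioc_mem_nhdsGT h₂] with s hs
  exact O.chron_imp_causal _ _ (O.chron_of_fplus_lt hs.1 hs.2)

theorem not_chron_fplus (O : ObsSetting M Vec Abar) {a : Abar} {q : M}
    (h₁ : -1 < O.fplus a q) (h₂ : O.fplus a q ≤ 1) :
    ¬ O.chron q (O.μpath a (O.fplus a q)) := by
  intro h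
  have hcont : Tendsto (O.μpath a) (𝓝[<] (O.fplus a q)) (𝓝 (O.μpath a (O.fplus a q))) :=
    ((O.continuousOn_μpath a _ ⟨h₁.le, h₂⟩).mono_of_mem_nhdsWithin <| by
      filter_upwards [Ico_mem_nhdsLT h₁] with s hs
      exact ⟨hs.1, hs.2.le.trans h₂⟩)
  obtain ⟨s, hs, hs'⟩ := (((tendsto_const_nhds.prodMk_nhds hcont).eventually
    (O.chron_isOpen.mem_nhds h)).and (Ico_mem_nhdsLT h₁)).exists
  exact O.not_causal_of_lt_fplus hs'.1 hs'.2 (O.chron_imp_causal _ _ hs)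

theorem timeSep_lt_of_causal (O : ObsSetting M Vec Abar) {a : Abar} {q : M} {s t : ℝ}
    (h₁ : -1 ≤ s) (hst : s < t) (h₂ : t ≤ 1) (h : O.causal q (O.μpath a s)) :
    O.timeSep q (O.μpath a s) < O.timeSep q (O.μpath a t) := by
  have hc := O.μ_timelike a s t h₁ hst h₂
  have := O.timeSep_rev_triangle _ _ _ h (O.chron_imp_causal _ _ hc)
  linarith [(O.timeSep_pos_iff _ _).2 hc]

theorem continuousOn_timeSep_μpath (O : ObsSetting M Vec Abar) (a : Abar) (q : M) :
    ContinuousOn (fun s : ℝ => O.timeSep q (O.μpath a s)) (Set.Icc (-1 : ℝ) 1) :=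
  O.timeSep_continuous.comp_continuousOn
    (continuousOn_const.prodMk (O.continuousOn_μpath a))

theorem monotoneOn_timeSep_μpath (O : ObsSetting M Vec Abar) (a : Abar) (q : M) :
    MonotoneOn (fun s : ℝ => O.timeSep q (O.μpath a s)) (Set.Icc (-1 : ℝ) 1) := by
  intro s hs t ht hst
  rcases hst.eq_or_lt with rfl | hst
  · exact le_rfl
  by_cases h : O.chron q (O.μpath a s)
  · exact (O.timeSep_lt_of_causal hs.1 hst ht.2 (O.chron_imp_causal _ _ h)).le
  · exact (not_lt.1 (mt (O.timeSep_pos_iff _ _).1 h)).trans (O.timeSep_nonneg _ _)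

theorem strictMonoOn_timeSep_μpath (O : ObsSetting M Vec Abar) {a : Abar} {q : M}
    (h₁ : -1 ≤ O.fplus a q) :
    StrictMonoOn (fun s : ℝ => O.timeSep q (O.μpath a s)) (Set.Icc (O.fplus a q) 1) := by
  intro s hs t ht hst
  refine O.timeSep_lt_of_causal (h₁.trans hs.1) hst ht.2 ?_
  rcases hs.1.eq_or_lt with h | h
  · rw [← h]
    exact O.causal_fplus h₁ (by linarith [ht.2])
  · exact O.chron_imp_causal _ _ (O.chron_of_fplus_lt h hs.2)

theorem continuousAt_fplus (O : ObsSetting M Vec Abar) {a : Abar} {q : M}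
    (h₁ : -1 < O.fplus a q) (h₂ : O.fplus a q < 1) :
    ContinuousAt (fun p : Abar × M => O.fplus p.1 p.2) (a, q) := by
  have hcont {s : ℝ} (hs : s ∈ Set.Icc (-1 : ℝ) 1) :
      Continuous fun p : Abar × M => (p.2, O.μpath p.1 s) :=
    continuous_snd.prodMk ((O.continuous_μpath_left hs).comp continuous_fst)
  refine tendsto_order.2 ⟨fun c hc => ?_, fun c hc => ?_⟩
  · obtain ⟨s, hs, hsf⟩ := exists_between (max_lt h₁ hc)
    obtain ⟨hs₁, hcs⟩ := max_lt_iff.1 hs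
    have hs₂ := (hsf.trans h₂).le
    filter_upwards [(O.causal_isClosed.isOpen_compl.preimage (hcont ⟨hs₁.le, hs₂⟩)).mem_nhds
      (O.not_causal_of_lt_fplus hs₁.le hsf)] with p hp
    exact hcs.trans_le (O.le_fplus_of_not_causal hs₂ hp)
  · obtain ⟨s, hfs, hs⟩ := exists_between (lt_min h₂ hc)
    obtain ⟨hs₂, hsc⟩ := lt_min_iff.1 hs
    have hs₁ := h₁.trans hfs
    filter_upwards [(O.chron_isOpen.preimage (hcont ⟨hs₁.le, hs₂.le⟩)).mem_nhds
      (O.chron_of_fplus_lt hfs hs₂.le)] with p hp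
    exact (O.fplus_le_of_chron hs₁ hs₂ hp).trans_lt hsc

end ObsSetting

/-- basic properties of the earliest observation time functions `f_a⁺`. -/
theorem observation_time_function_properties
    {M Vec Abar : Type} [TopologicalSpace M] [MetricSpace Abar] [CompactSpace Abar]
    (O : ObsSetting M Vec Abar) :
    (∀ (a : Abar) (q : M),
      q ∈ O.toSpacetime.Jpast O.pplus \ O.toSpacetime.Ipast O.pminus →
      O.sm2 ≤ O.fplus a q ∧ O.fplus a q ≤ O.sp2) ∧
    (∀ (a : Abar) (q : M),
      q ∈ O.toSpacetime.Jpast O.pplus \ O.toSpacetime.Ipast O.pminus →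
      O.μpath a (O.fplus a q) ∈ O.toSpacetime.Jfut q ∧
      O.timeSep q (O.μpath a (O.fplus a q)) = 0 ∧
      ContinuousOn (fun s : ℝ => O.timeSep q (O.μpath a s)) (Set.Icc (-1 : ℝ) 1) ∧
      MonotoneOn (fun s : ℝ => O.timeSep q (O.μpath a s)) (Set.Icc (-1 : ℝ) 1) ∧
      StrictMonoOn (fun s : ℝ => O.timeSep q (O.μpath a s)) (Set.Icc (O.fplus a q) 1)) ∧
    ContinuousOn (fun p : Abar × M => O.fplus p.1 p.2)
      (Set.univ ×ˢ (O.toSpacetime.Jpast O.pplus \ O.toSpacetime.Ipast O.pminus)) := by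
  have hlow (a : Abar) {q : M} (hq : ¬ O.chron q O.pminus) : -1 < O.fplus a q :=
    O.hs1.trans_le (O.sm2_le_fplus a hq)
  have hhigh (a : Abar) {q : M} (hq : O.causal q O.pplus) : O.fplus a q < 1 :=
    (O.fplus_le_sp2 a hq).trans_lt O.hs5
  refine ⟨fun a q hq => ⟨O.sm2_le_fplus a hq.2, O.fplus_le_sp2 a hq.1⟩, fun a q hq => ?_, ?_⟩
  · have h₁ := hlow a hq.2
    have h₂ := hhigh a hq.1
    exact ⟨O.causal_fplus h₁.le h₂,
      le_antisymm (not_lt.1 (mt (O.timeSep_pos_iff _ _).1 (O.not_chron_fplus h₁ h₂.le)))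
        (O.timeSep_nonneg _ _),
      O.continuousOn_timeSep_μpath a q, O.monotoneOn_timeSep_μpath a q,
      O.strictMonoOn_timeSep_μpath h₁.le⟩
  · rintro ⟨a, q⟩ ⟨-, hq⟩
    exact (O.continuousAt_fplus (hlow a hq.2) (hhigh a hq.1)).continuousWithinAt
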